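/- Let (X,E) be a connected combinatorial graph with uniformly bounded vertex degree δ := sup_x #{y : {x,y} ∈ E} < ∞, and let H be the combinatorial graph Laplacian on ℓ²(X). If for one (equivalently, all) x ∈ X the ball volumes grow subexponentially, i.e. limsup_{n→∞} (log #B_n(x))/n = 0, then inf σ(H) = 0. -/

import Mathlib

variable {X : Type*}

/-- The energy form of the combinatorial graph Laplacian:
`E(f,f) = (1/2) ∑_{x,y adjacent} (f(x) − f(y))²`. -/
noncomputable def combEnergy (G : SimpleGraph X) [DecidableRel G.Adj] (f : X → ℝ) : ℝ :=
  (1 / 2) * ∑' p : X × X, if G.Adj p.1 p.2 then (f p.1 - f p.2) ^ 2 else 0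

theorem aux_ball_step (G : SimpleGraph X) (hconn : G.Connected) (x z : X) (n : ℕ)
    (hz : G.dist x z ≤ n + 1) : ∃ y, G.dist x y ≤ n ∧ (z = y ∨ G.Adj y z) := by
  by_cases h : G.dist x z ≤ n
  · exact ⟨z, h, Or.inl rfl⟩
  · obtain ⟨p, hp⟩ := (hconn z x).exists_walk_length_eq_dist
    rw [SimpleGraph.dist_comm] at hp
    cases p with
    | nil => exact absurd (by simp) h
    | cons hadj q =>
      rename_i w
      refine ⟨w, ?_, Or.inr hadj.symm⟩
      rw [SimpleGraph.dist_comm]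
      have := SimpleGraph.dist_le q
      simp at hp
      omega

theorem aux_ball_fin (G : SimpleGraph X) (hconn : G.Connected)
    (hfin : ∀ x, (G.neighborSet x).Finite) (δ : ℕ)
    (hδ : ∀ x, (G.neighborSet x).ncard ≤ δ) (x : X) (n : ℕ) :
    ({y | G.dist x y ≤ n} : Set X).Finite ∧ ({y | G.dist x y ≤ n} : Set X).ncard ≤ (δ + 1) ^ n := by
  classical
  induction n with
  | zero =>
    have : ({y | G.dist x y ≤ 0} : Set X) = {x} := by
      ext y
      simp [hconn.dist_eq_zero_iff, eq_comm]
    rw [this]; simp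
  | succ n ih =>
    obtain ⟨hf, hc⟩ := ih
    let T : Finset X := hf.toFinset.biUnion (fun y => insert y (hfin y).toFinset)
    have hsub : ({y | G.dist x y ≤ n + 1} : Set X) ⊆ (T : Set X) := by
      intro z hz
      obtain ⟨y, hy, h⟩ := aux_ball_step G hconn x z n hz
      simp only [T, Finset.mem_coe, Finset.mem_biUnion, Finset.mem_insert, Set.Finite.mem_toFinset]
      exact ⟨y, hy, h⟩
    refine ⟨T.finite_toSet.subset hsub, (Set.ncard_le_ncard hsub T.finite_toSet).trans ?_⟩
    rw [Set.ncard_coe_finset]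
    have h1 : T.card ≤ hf.toFinset.card * (δ + 1) := by
      refine Finset.card_biUnion_le_card_mul _ _ _ fun y _ => ?_
      refine (Finset.card_insert_le _ _).trans ?_
      have := hδ y
      rw [Set.ncard_eq_toFinset_card _ (hfin y)] at this
      omega
    rw [← Set.ncard_eq_toFinset_card _ hf] at h1
    rw [pow_succ]
    exact h1.trans (Nat.mul_le_mul_right _ hc)

theorem aux_energy (G : SimpleGraph X) [DecidableRel G.Adj]
    (hfin : ∀ x, (G.neighborSet x).Finite) (δ : ℕ)
    (hδ : ∀ x, (G.neighborSet x).ncard ≤ δ) (B B' : Finset X) (hBB : B ⊆ B')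
    (hnb : ∀ x ∈ B, ∀ y, G.Adj x y → y ∈ B') :
    combEnergy G (Set.indicator (B : Set X) 1) ≤ δ * ((B'.card : ℝ) - B.card) := by
  classical
  let T : Finset (X × X) := (B' \ B).biUnion (fun y => (hfin y).toFinset.image (fun x => (x, y)))
  let T' : Finset (X × X) := T.image Prod.swap
  have hT : T.card ≤ (B' \ B).card * δ := by
    refine Finset.card_biUnion_le_card_mul _ _ _ fun y _ => ?_
    refine Finset.card_image_le.trans ?_
    rw [← Set.ncard_eq_toFinset_card _ (hfin y)]
    exact hδ y
  have hU : (T ∪ T').card ≤ 2 * ((B' \ B).card * δ) := by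
    have h1 := Finset.card_union_le T T'
    have h2 : T'.card ≤ T.card := Finset.card_image_le
    omega
  have hzero : ∀ p ∉ T ∪ T', (if G.Adj p.1 p.2 then
      (Set.indicator (B : Set X) (1 : X → ℝ) p.1 - Set.indicator (B : Set X) 1 p.2) ^ 2 else 0) = 0 := by
    rintro ⟨a, b⟩ hp
    by_cases hab : G.Adj a b
    · simp only [hab, if_true]
      by_cases ha : a ∈ B <;> by_cases hb : b ∈ B
      · simp [ha, hb]
      · exfalso; apply hp
        simp only [T, T', Finset.mem_union, Finset.mem_biUnion, Finset.mem_image, Finset.mem_sdiff,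
          Set.Finite.mem_toFinset]
        exact Or.inl ⟨b, ⟨hnb a ha b hab, hb⟩, a, hab.symm, rfl⟩
      · exfalso; apply hp
        simp only [T, T', Finset.mem_union, Finset.mem_biUnion, Finset.mem_image, Finset.mem_sdiff,
          Set.Finite.mem_toFinset]
        exact Or.inr ⟨(b, a), ⟨a, ⟨hnb b hb a hab.symm, ha⟩, b, hab, rfl⟩, rfl⟩
      · simp [ha, hb]
    · simp [hab]
  unfold combEnergy
  rw [tsum_eq_sum hzero]
  have hle : ∑ p ∈ T ∪ T', (if G.Adj p.1 p.2 then
      (Set.indicator (B : Set X) (1 : X → ℝ) p.1 - Set.indicator (B : Set X) 1 p.2) ^ 2 else 0)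
      ≤ ∑ p ∈ T ∪ T', (1 : ℝ) := by
    refine Finset.sum_le_sum fun p _ => ?_
    by_cases ha : p.1 ∈ B <;> by_cases hb : p.2 ∈ B <;> by_cases hab : G.Adj p.1 p.2 <;>
      simp [ha, hb, hab]
  have hU' : ((T ∪ T').card : ℝ) ≤ 2 * (((B' \ B).card : ℝ) * δ) := by exact_mod_cast hU
  have hcard : ((B' \ B).card : ℝ) = (B'.card : ℝ) - B.card := by
    rw [Finset.cast_card_sdiff hBB]
  rw [hcard] at hU'
  simp only [Finset.sum_const, nsmul_eq_mul, mul_one] at hle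
  linarith

/-- Proposition 6.1. Let `(X,E)` be a connected
combinatorial graph with uniformly bounded vertex degree and let `H` be the
combinatorial graph Laplacian on `ℓ²(X)`. If for one vertex `x` the volume of
balls grows subexponentially, i.e. `limsup_n log(#B_n(x))/n = 0`, then
`inf σ(H) = 0`. The bottom of the spectrum of the (bounded, nonnegative,
self-adjoint) operator `H` is expressed through its variational
characterization as the infimum of the Rayleigh quotients `E(f,f)/‖f‖²` over
nonzero `f ∈ ℓ²(X)`. -/
theorem statement_17 [Countable X] [Nonempty X]
    (G : SimpleGraph X) [DecidableRel G.Adj]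
    (hconn : G.Connected)
    (hfin : ∀ x, (G.neighborSet x).Finite)
    (hdeg : ∃ δ : ℕ, ∀ x, (G.neighborSet x).ncard ≤ δ)
    (hsub : ∃ x : X, Filter.limsup
      (fun n : ℕ => Real.log ({y | G.dist x y ≤ n}.ncard : ℝ) / (n : ℝ))
      Filter.atTop = 0) :
    sInf {r : ℝ | ∃ f : X → ℝ, Summable (fun x => f x ^ 2) ∧ f ≠ 0 ∧
      r = combEnergy G f / ∑' x, f x ^ 2} = 0 := by
  classical
  obtain ⟨δ, hδ⟩ := hdeg
  obtain ⟨x, hx⟩ := hsub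
  set A := {r : ℝ | ∃ f : X → ℝ, Summable (fun x => f x ^ 2) ∧ f ≠ 0 ∧
      r = combEnergy G f / ∑' x, f x ^ 2} with hA
  have hnn : ∀ r ∈ A, 0 ≤ r := by
    rintro r ⟨f, -, -, rfl⟩
    refine div_nonneg ?_ (tsum_nonneg fun _ => sq_nonneg _)
    refine mul_nonneg (by norm_num) (tsum_nonneg fun p => ?_)
    split_ifs
    · exact sq_nonneg _
    · exact le_rfl
  by_contra hne
  have hpos : 0 < sInf A := lt_of_le_of_ne (Real.sInf_nonneg hnn) (Ne.symm hne)
  set ε := sInf A with hε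
  have hlow : ∀ r ∈ A, ε ≤ r := fun r hr => csInf_le ⟨0, fun r hr => hnn r hr⟩ hr
  have hb := aux_ball_fin G hconn hfin δ hδ x
  let B : ℕ → Finset X := fun n => (hb n).1.toFinset
  have hBmem : ∀ n y, y ∈ B n ↔ G.dist x y ≤ n := fun n y => by simp [B]
  have hBV : ∀ n : ℕ, ({y | G.dist x y ≤ n} : Set X).ncard = (B n).card := fun n =>
    Set.ncard_eq_toFinset_card _ (hb n).1
  have hxB : ∀ n, x ∈ B n := fun n => by simp [hBmem]
  have hB1 : ∀ n, (1 : ℝ) ≤ (B n).card := fun n => by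
    exact_mod_cast Finset.card_pos.mpr ⟨x, hxB n⟩
  have hBB : ∀ n, B n ⊆ B (n + 1) := fun n y hy => by
    rw [hBmem] at *; omega
  have key : ∀ n, ε * (B n).card ≤ (δ + 1) * (((B (n+1)).card : ℝ) - (B n).card) := by
    intro n
    have hE := aux_energy G hfin δ hδ (B n) (B (n+1)) (hBB n) (by
      intro a ha b hab
      rw [hBmem] at *
      have h1 := hconn.dist_triangle (u := x) (v := a) (w := b)
      have h2 := SimpleGraph.dist_eq_one_iff_adj.mpr hab
      omega)
    have hz : ∀ y ∉ B n, (Set.indicator (B n : Set X) (1 : X → ℝ) y) ^ 2 = 0 := by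
      intro y hy; simp [hy]
    have hsum : ∑' y, (Set.indicator (B n : Set X) (1 : X → ℝ) y) ^ 2 = (B n).card := by
      rw [tsum_eq_sum hz, Finset.sum_congr rfl (g := fun _ => (1 : ℝ))]
      · simp
      · intro y hy; simp [hy]
    have hr := hlow _ ⟨Set.indicator (B n : Set X) (1 : X → ℝ),
      summable_of_ne_finset_zero hz, fun h => by
        have := congrFun h x
        simp [hxB n] at this, rfl⟩
    rw [hsum, le_div_iff₀ (by linarith [hB1 n])] at hr
    have : ((B n).card : ℝ) ≤ (B (n+1)).card := by exact_mod_cast Finset.card_le_card (hBB n)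
    linarith
  have hδp : (0 : ℝ) < δ + 1 := by positivity
  set c : ℝ := 1 + ε / (δ + 1) with hc
  have hc1 : 1 < c := by
    have : 0 < ε / (δ + 1) := div_pos hpos hδp
    linarith
  have hgrow : ∀ n, c ^ n ≤ (B n).card := by
    intro n
    induction n with
    | zero => simpa using hB1 0
    | succ n ih =>
      have h1 : ε / (δ + 1) * (B n).card ≤ ((B (n+1)).card : ℝ) - (B n).card := by
        rw [div_mul_eq_mul_div, div_le_iff₀ hδp]
        linarith [key n]
      have h2 : c ^ n * c ≤ (B n).card * c := mul_le_mul_of_nonneg_right ih (by linarith)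
      rw [pow_succ]
      refine h2.trans ?_
      rw [hc]; linarith
  have hlogc : 0 < Real.log c := Real.log_pos hc1
  have hbdd : Filter.IsBoundedUnder (· ≤ ·) Filter.atTop
      (fun n : ℕ => Real.log ({y | G.dist x y ≤ n}.ncard : ℝ) / (n : ℝ)) := by
    refine Filter.isBoundedUnder_of ⟨Real.log (δ + 1), fun n => ?_⟩
    rcases Nat.eq_zero_or_pos n with rfl | hn
    · simp only [Nat.cast_zero, div_zero]
      exact Real.log_nonneg (by linarith [(Nat.cast_nonneg δ : (0 : ℝ) ≤ δ)])
    · rw [div_le_iff₀ (by exact_mod_cast hn), mul_comm, ← Real.log_pow]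
      apply Real.log_le_log
      · rw [hBV]; linarith [hB1 n]
      · exact_mod_cast (hb n).2
  have hev := Filter.eventually_lt_of_limsup_lt (hx.trans_lt hlogc) hbdd
  obtain ⟨n, hn, hn1⟩ := (hev.and (Filter.eventually_ge_atTop 1)).exists
  have hnp : (0 : ℝ) < n := by exact_mod_cast hn1
  rw [div_lt_iff₀ hnp, mul_comm, ← Real.log_pow, hBV] at hn
  exact absurd hn (not_lt.mpr (Real.log_le_log (by positivity) (hgrow n)))
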